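/- arXiv:2512.23108 — 5 statements merged into one kernel-verified Lean document; each statement's English description precedes it below -/
import Mathlib

section
/- Let Y ⊆ X be a nonempty subset contained in some member of 𝒲, and let μ₀ ∈ P^Y. Then P^Y (with the subspace topology from V^m(𝒲)) strongly deformation retracts onto μ₀: there is a continuous map H : [0,1] × P^Y → P^Y with H(0,ν) = ν for all ν ∈ P^Y, H(1,ν) = μ₀ for all ν ∈ P^Y, and H(t,μ₀) = μ₀ for all t ∈ [0,1]. In particular, P^Y is a contractible topological space. -/
open MeasureTheory Set

/-- The support of a probability measure: the set of points all of whose open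
neighborhoods have positive measure. -/
def msupp {X : Type*} [TopologicalSpace X] [MeasurableSpace X]
    (μ : ProbabilityMeasure X) : Set X :=
  {x | ∀ U : Set X, IsOpen U → x ∈ U → μ.toMeasure U ≠ 0}

/-- The Vietoris metric thickening of a cover `𝒲`. -/
def VietorisThickening {X : Type*} [TopologicalSpace X] [MeasurableSpace X]
    (𝒲 : Set (Set X)) : Set (ProbabilityMeasure X) :=
  {μ | (msupp μ).Finite ∧ ∃ W ∈ 𝒲, msupp μ ⊆ W}

/-- `P^Y`: the members of the Vietoris metric thickening whose support lies in `Y`. -/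
def Psup {X : Type*} [TopologicalSpace X] [MeasurableSpace X]
    (𝒲 : Set (Set X)) (Y : Set X) : Set (ProbabilityMeasure X) :=
  {μ | μ ∈ VietorisThickening 𝒲 ∧ msupp μ ⊆ Y}

/-- The convex combination `(1 - t) μ + t ν` of two probability measures. -/
noncomputable def MeasureTheory.ProbabilityMeasure.mix {X : Type*} [MeasurableSpace X]
    (t : unitInterval) (μ ν : ProbabilityMeasure X) : ProbabilityMeasure X :=
  ⟨ENNReal.ofReal (1 - t) • (μ : Measure X) + ENNReal.ofReal t • (ν : Measure X), ⟨by
    simp [← ENNReal.ofReal_add (sub_nonneg.2 t.2.2) t.2.1]⟩⟩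

namespace MeasureTheory.ProbabilityMeasure

variable {X : Type*} [MeasurableSpace X]

theorem coe_mix (t : unitInterval) (μ ν : ProbabilityMeasure X) :
    (mix t μ ν : Measure X) =
      ENNReal.ofReal (1 - t) • (μ : Measure X) + ENNReal.ofReal t • (ν : Measure X) :=
  rfl

@[simp]
theorem mix_zero (μ ν : ProbabilityMeasure X) : mix 0 μ ν = μ :=
  Subtype.ext (by simp [mix])

@[simp]
theorem mix_one (μ ν : ProbabilityMeasure X) : mix 1 μ ν = ν :=
  Subtype.ext (by simp [mix])

@[simp]
theorem mix_self (t : unitInterval) (μ : ProbabilityMeasure X) : mix t μ μ = μ :=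
  Subtype.ext (by
    simp [mix, ← add_smul, ← ENNReal.ofReal_add (sub_nonneg.2 t.2.2) t.2.1])

variable [TopologicalSpace X]

theorem msupp_mix_subset (t : unitInterval) (μ ν : ProbabilityMeasure X) :
    msupp (mix t μ ν) ⊆ msupp μ ∪ msupp ν := by
  intro x hx
  by_contra h
  simp only [msupp, mem_union, mem_ofPred_eq, not_or, not_forall, not_not] at h
  obtain ⟨⟨U, hU, hxU, hμU⟩, V, hV, hxV, hνV⟩ := h
  refine hx (U ∩ V) (hU.inter hV) ⟨hxU, hxV⟩ ?_
  have h₁ : (μ : Measure X) (U ∩ V) = 0 := measure_mono_null inter_subset_left hμU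
  have h₂ : (ν : Measure X) (U ∩ V) = 0 := measure_mono_null inter_subset_right hνV
  change (mix t μ ν : Measure X) (U ∩ V) = 0
  simp [coe_mix, h₁, h₂]

theorem mix_mem_Psup {𝒲 : Set (Set X)} {W Y : Set X} (hW : W ∈ 𝒲) (hYW : Y ⊆ W)
    (t : unitInterval) {μ ν : ProbabilityMeasure X} (hμ : μ ∈ Psup 𝒲 Y) (hν : ν ∈ Psup 𝒲 Y) :
    mix t μ ν ∈ Psup 𝒲 Y := by
  have h := msupp_mix_subset t μ ν
  have hY := h.trans (union_subset hμ.2 hν.2)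
  exact ⟨⟨(hμ.1.1.union hν.1.1).subset h, W, hW, hY.trans hYW⟩, hY⟩

variable [OpensMeasurableSpace X]

theorem integral_mix (t : unitInterval) (μ ν : ProbabilityMeasure X)
    (f : BoundedContinuousFunction X ℝ) :
    ∫ x, f x ∂(mix t μ ν : Measure X) =
      (1 - (t : ℝ)) * ∫ x, f x ∂(μ : Measure X) + t * ∫ x, f x ∂(ν : Measure X) := by
  rw [coe_mix, integral_add_measure ((f.integrable _).smul_measure ENNReal.ofReal_ne_top)
    ((f.integrable _).smul_measure ENNReal.ofReal_ne_top), integral_smul_measure,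
    integral_smul_measure, ENNReal.toReal_ofReal (sub_nonneg.2 t.2.2),
    ENNReal.toReal_ofReal t.2.1, smul_eq_mul, smul_eq_mul]

theorem continuous_mix :
    Continuous fun p : unitInterval × ProbabilityMeasure X × ProbabilityMeasure X ↦
      mix p.1 p.2.1 p.2.2 := by
  rw [continuous_iff_continuousAt]
  intro p
  rw [ContinuousAt, tendsto_iff_forall_integral_tendsto]
  intro f
  simp only [integral_mix]
  have hf : Continuous fun μ : ProbabilityMeasure X ↦ ∫ x, f x ∂(μ : Measure X) :=
    continuous_iff_continuousAt.2 fun μ ↦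
      tendsto_iff_forall_integral_tendsto.1 Filter.tendsto_id f
  have hc : Continuous fun p : unitInterval × ProbabilityMeasure X × ProbabilityMeasure X ↦
      (1 - (p.1 : ℝ)) * ∫ x, f x ∂(p.2.1 : Measure X) +
        (p.1 : ℝ) * ∫ x, f x ∂(p.2.2 : Measure X) := by
    have h₁ := hf.comp (continuous_fst.comp continuous_snd :
      Continuous fun p : unitInterval × ProbabilityMeasure X × ProbabilityMeasure X ↦ p.2.1)
    have h₂ := hf.comp (continuous_snd.comp continuous_snd :
      Continuous fun p : unitInterval × ProbabilityMeasure X × ProbabilityMeasure X ↦ p.2.2)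
    have h₀ : Continuous fun p : unitInterval × ProbabilityMeasure X × ProbabilityMeasure X ↦
      (p.1 : ℝ) := by fun_prop
    exact ((continuous_const.sub h₀).mul h₁).add (h₀.mul h₂)
  exact hc.tendsto p

end MeasureTheory.ProbabilityMeasure

theorem stmt_2 {X : Type*} [MetricSpace X] [CompactSpace X] [MeasurableSpace X] [BorelSpace X]
    (𝒲 : Set (Set X)) (hWopen : ∀ W ∈ 𝒲, IsOpen W) (hWcover : ⋃₀ 𝒲 = Set.univ)
    (D : ℝ) (hD : 0 < D) (hWbdd : ∀ W ∈ 𝒲, Metric.diam W < D)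
    (Y : Set X) (hYne : Y.Nonempty) (W : Set X) (hW : W ∈ 𝒲) (hYW : Y ⊆ W)
    (μ₀ : ProbabilityMeasure X) (hμ₀ : μ₀ ∈ Psup 𝒲 Y) :
    (∃ H : unitInterval × ↥(Psup 𝒲 Y) → ↥(Psup 𝒲 Y),
      Continuous H ∧
      (∀ ν, H (0, ν) = ν) ∧
      (∀ ν, H (1, ν) = ⟨μ₀, hμ₀⟩) ∧
      (∀ t, H (t, ⟨μ₀, hμ₀⟩) = ⟨μ₀, hμ₀⟩)) ∧
    ContractibleSpace ↥(Psup 𝒲 Y) := by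
  let H : unitInterval × ↥(Psup 𝒲 Y) → ↥(Psup 𝒲 Y) := fun p ↦
    ⟨.mix p.1 p.2 μ₀, ProbabilityMeasure.mix_mem_Psup hW hYW p.1 p.2.2 hμ₀⟩
  have hH : Continuous H :=
    (ProbabilityMeasure.continuous_mix.comp (continuous_fst.prodMk
      ((continuous_subtype_val.comp continuous_snd).prodMk continuous_const))).subtype_mk _
  have h0 : ∀ ν, H (0, ν) = ν := fun ν ↦ Subtype.ext (ProbabilityMeasure.mix_zero _ _)
  have h1 : ∀ ν, H (1, ν) = ⟨μ₀, hμ₀⟩ := fun ν ↦ Subtype.ext (ProbabilityMeasure.mix_one _ _)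
  refine ⟨⟨H, hH, h0, h1, fun t ↦ Subtype.ext (ProbabilityMeasure.mix_self _ _)⟩, ?_⟩
  rw [contractible_iff_id_nullhomotopic]
  exact ⟨⟨μ₀, hμ₀⟩, ⟨{
    toFun := H
    continuous_toFun := hH, map_zero_left := h0, map_one_left := h1 }⟩⟩
end

section
/- Let η ∈ V^m(𝒲) have support {y_1,…,y_n}, let 𝒰 = {U_1,…,U_n} be pairwise disjoint open subsets of X with y_i ∈ U_i for all i and with U_1 ∪ ⋯ ∪ U_n contained in some member of 𝒲, and let ε > 0. Then there exist finitely many continuous functions h_1,…,h_k : X → ℝ such that O(η, h_1,…,h_k, ε) ⊆ N(η,𝒰,ε). -/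
open MeasureTheory Set

/-- The basic set `N(η,𝒰,ε)`. -/
def Nnbhd {X : Type*} [TopologicalSpace X] [MeasurableSpace X]
    (𝒲 : Set (Set X)) (η : ProbabilityMeasure X) {n : ℕ} (U : Fin n → Set X) (ε : ℝ) :
    Set (ProbabilityMeasure X) :=
  {ν | ν ∈ VietorisThickening 𝒲 ∧ ∀ i, |(η (U i) : ℝ) - (ν (U i) : ℝ)| < ε}

/-- The basic weak-topology set `O(η, h₁,…,h_k, ε)`. -/
def Onbhd {X : Type*} [MetricSpace X] [MeasurableSpace X]
    (𝒲 : Set (Set X)) (η : ProbabilityMeasure X) {k : ℕ} (h : Fin k → C(X, ℝ)) (ε : ℝ) :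
    Set (ProbabilityMeasure X) :=
  {ν | ν ∈ VietorisThickening 𝒲 ∧
    ∀ t, |(∫ x, h t x ∂η.toMeasure) - (∫ x, h t x ∂ν.toMeasure)| < ε}

/-- A Borel probability measure on a second countable space is carried by its support. -/
theorem ae_mem_msupp {X : Type*} [TopologicalSpace X] [SecondCountableTopology X]
    [MeasurableSpace X] (μ : ProbabilityMeasure X) : ∀ᵐ x ∂μ.toMeasure, x ∈ msupp μ := by
  refine measure_null_of_locally_null _ fun x hx => ?_
  obtain ⟨V, hV, hxV, hμV⟩ : ∃ V : Set X, IsOpen V ∧ x ∈ V ∧ μ.toMeasure V = 0 := by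
    simpa [msupp] using hx
  exact ⟨V, mem_nhdsWithin_of_mem_nhds (hV.mem_nhds hxV), hμV⟩

/-- An open set whose frontier misses a closed set `F` has indicator function squeezed between two
continuous functions that agree with it on `F`. -/
theorem exists_continuous_squeeze_indicator {X : Type*} [TopologicalSpace X] [NormalSpace X]
    {F U : Set X} (hF : IsClosed F) (hU : IsOpen U) (hFU : F ∩ closure U ⊆ U) :
    ∃ f g : C(X, ℝ), (∀ x, f x ≤ U.indicator 1 x) ∧ (∀ x, U.indicator 1 x ≤ g x) ∧
      EqOn f (U.indicator 1) F ∧ EqOn g (U.indicator 1) F := by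
  have hFU' : F ∩ U = F ∩ closure U :=
    Subset.antisymm (inter_subset_inter_right F subset_closure) fun x hx => ⟨hx.1, hFU hx⟩
  obtain ⟨f, hf0, hf1, hf⟩ := exists_continuous_zero_one_of_isClosed hU.isClosed_compl
    (hFU' ▸ hF.inter isClosed_closure : IsClosed (F ∩ U))
    (disjoint_left.2 fun x hx hx' => hx hx'.2)
  obtain ⟨g, hg0, hg1, hg⟩ := exists_continuous_zero_one_of_isClosed (hF.sdiff hU)
    (isClosed_closure (s := U)) (disjoint_left.2 fun x hx hx' => hx.2 (hFU ⟨hx.1, hx'⟩))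
  refine ⟨f, g, fun x => ?_, fun x => ?_, fun x hx => ?_, fun x hx => ?_⟩ <;>
    by_cases hxU : x ∈ U
  · simpa [hxU] using (hf x).2
  · simpa [hxU] using (hf0 hxU).le
  · simpa [hxU] using (hg1 (subset_closure hxU)).ge
  · simpa [hxU] using (hg x).1
  · simpa [hxU] using hf1 ⟨hx, hxU⟩
  · simpa [hxU] using hf0 hxU
  · simpa [hxU] using hg1 (subset_closure hxU)
  · simpa [hxU] using hg0 ⟨hx, hxU⟩

theorem stmt_5 {X : Type*} [MetricSpace X] [CompactSpace X] [MeasurableSpace X] [BorelSpace X]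
    (𝒲 : Set (Set X)) (hWopen : ∀ W ∈ 𝒲, IsOpen W) (hWcover : ⋃₀ 𝒲 = Set.univ)
    (D : ℝ) (hD : 0 < D) (hWbdd : ∀ W ∈ 𝒲, Metric.diam W < D)
    (η : ProbabilityMeasure X) (hη : η ∈ VietorisThickening 𝒲)
    (n : ℕ) (y : Fin n → X) (hyinj : Function.Injective y)
    (hysupp : msupp η = Set.range y)
    (U : Fin n → Set X) (hUopen : ∀ i, IsOpen (U i))
    (hUdisj : Pairwise (Function.onFun Disjoint U))
    (hyU : ∀ i, y i ∈ U i)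
    (hUW : ∃ W ∈ 𝒲, (⋃ i, U i) ⊆ W)
    (ε : ℝ) (hε : 0 < ε) :
    ∃ (k : ℕ) (h : Fin k → C(X, ℝ)),
      Onbhd 𝒲 η h ε ⊆ Nnbhd 𝒲 η U ε := by
  have hF : IsClosed (range y) := (finite_range y).isClosed
  have hFU (i : Fin n) : range y ∩ closure (U i) ⊆ U i := by
    rintro _ ⟨⟨j, rfl⟩, hj⟩
    obtain rfl | hij := eq_or_ne i j
    · exact hyU i
    · exact absurd (hyU j) (disjoint_left.1 ((hUdisj hij).closure_left (hUopen j)) hj)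
  choose f g hf hg hfF hgF using
    fun i => exists_continuous_squeeze_indicator hF (hUopen i) (hFU i)
  have hae : ∀ᵐ x ∂η.toMeasure, x ∈ range y := hysupp ▸ ae_mem_msupp η
  have hint (μ : ProbabilityMeasure X) (i : Fin n) :
      ∫ x, (U i).indicator (1 : X → ℝ) x ∂μ.toMeasure = μ (U i) :=
    integral_indicator_one (hUopen i).measurableSet
  have hηf (i : Fin n) : ∫ x, f i x ∂η.toMeasure = η (U i) :=
    (integral_congr_ae (hae.mono fun x hx => hfF i hx)).trans (hint η i)
  have hηg (i : Fin n) : ∫ x, g i x ∂η.toMeasure = η (U i) :=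
    (integral_congr_ae (hae.mono fun x hx => hgF i hx)).trans (hint η i)
  refine ⟨n + n, Fin.append f g, fun ν hν => ⟨hν.1, fun i => ?_⟩⟩
  have hνf := hν.2 (Fin.castAdd n i)
  have hνg := hν.2 (Fin.natAdd n i)
  rw [Fin.append_left, hηf, abs_lt] at hνf
  rw [Fin.append_right, hηg, abs_lt] at hνg
  have hintegrable (h : C(X, ℝ)) : Integrable h ν.toMeasure :=
    h.continuous.integrable_of_hasCompactSupport (.of_compactSpace h)
  have hind : Integrable ((U i).indicator (1 : X → ℝ)) ν.toMeasure :=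
    (integrable_const 1).indicator (hUopen i).measurableSet
  have hle := (integral_mono (hintegrable (f i)) hind (hf i)).trans_eq (hint ν i)
  have hge := (hint ν i).symm.trans_le (integral_mono hind (hintegrable (g i)) (hg i))
  exact abs_lt.2 ⟨by linarith, by linarith⟩
end

section
/- Let μ ∈ V^m(𝒲) have support {x_1,…,x_n}, let 𝒰 = {U_1,…,U_n} be pairwise disjoint open subsets of X with x_i ∈ U_i for all i and with U_1 ∪ ⋯ ∪ U_n contained in some member of 𝒲, and let ε > 0. Then for every ζ ∈ P_𝒰, the set F(ζ) is nonempty, convex (closed under the convex combinations t·ν₁ + (1−t)·ν₂ for t ∈ [0,1]), and closed in P(X). -/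
open MeasureTheory Set
open scoped NNReal

/-- The set `P(μ,𝒰,ε)`. -/
def Pnbhd {X : Type*} [TopologicalSpace X] [MeasurableSpace X]
    (𝒲 : Set (Set X)) (μ : ProbabilityMeasure X) {n : ℕ} (U : Fin n → Set X) (ε : ℝ) :
    Set (ProbabilityMeasure X) :=
  {ν | ν ∈ VietorisThickening 𝒲 ∧ msupp ν ⊆ ⋃ i, U i ∧
    ∀ i, |(ν (U i) : ℝ) - (μ (U i) : ℝ)| ≤ ε}

/-- The set `P_𝒰` of measures in the thickening whose support meets every `U i`. -/
def PmeetsAll {X : Type*} [TopologicalSpace X] [MeasurableSpace X]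
    (𝒲 : Set (Set X)) {n : ℕ} (U : Fin n → Set X) : Set (ProbabilityMeasure X) :=
  {ζ | ζ ∈ VietorisThickening 𝒲 ∧ ∀ i, (msupp ζ ∩ U i).Nonempty}

/-- The set-valued map `F`. -/
def Fmap {X : Type*} [TopologicalSpace X] [MeasurableSpace X]
    (𝒲 : Set (Set X)) (μ : ProbabilityMeasure X) {n : ℕ} (U : Fin n → Set X) (ε : ℝ)
    (ζ : ProbabilityMeasure X) : Set (ProbabilityMeasure X) :=
  {ν | ν ∈ Pnbhd 𝒲 μ U ε ∧ msupp ν ⊆ msupp ζ}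

open Filter Topology BoundedContinuousFunction

section Support

variable {X : Type*} [TopologicalSpace X] [MeasurableSpace X]

theorem msupp_subset_iff_measure_compl_eq_zero [SecondCountableTopology X]
    {ν : ProbabilityMeasure X} {A : Set X} (hA : IsClosed A) :
    msupp ν ⊆ A ↔ ν.toMeasure Aᶜ = 0 := by
  constructor
  · intro h
    refine measure_null_of_locally_null _ fun y hy => ?_
    have hy' : y ∉ msupp ν := fun hmem => hy (h hmem)
    simp only [msupp, mem_ofPred_eq, not_forall, not_not] at hy'
    obtain ⟨V, hVo, hyV, hV⟩ := hy'
    exact ⟨V, mem_nhdsWithin_of_mem_nhds (hVo.mem_nhds hyV), hV⟩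
  · intro h y hy
    by_contra hyA
    exact hy Aᶜ hA.isOpen_compl hyA h

theorem isClosed_setOf_measure_eq_zero [OpensMeasurableSpace X] [HasOuterApproxClosed X]
    {G : Set X} (hG : IsOpen G) :
    IsClosed {ν : ProbabilityMeasure X | ν.toMeasure G = 0} := by
  refine isClosed_of_closure_subset fun ν hν => ?_
  have : (𝓝[{ν : ProbabilityMeasure X | ν.toMeasure G = 0}] ν).NeBot :=
    mem_closure_iff_nhdsWithin_neBot.1 hν
  have hlim : Tendsto (id : ProbabilityMeasure X → ProbabilityMeasure X)
      (𝓝[{ν : ProbabilityMeasure X | ν.toMeasure G = 0}] ν) (𝓝 ν) :=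
    tendsto_id.mono_left nhdsWithin_le_nhds
  have hle := ProbabilityMeasure.le_liminf_measure_open_of_tendsto hlim hG
  have hzero : Tendsto (fun ρ : ProbabilityMeasure X => (id ρ).toMeasure G)
      (𝓝[{ν : ProbabilityMeasure X | ν.toMeasure G = 0}] ν) (𝓝 0) :=
    tendsto_const_nhds.congr' (eventually_nhdsWithin_of_forall fun ρ hρ => Eq.symm hρ)
  rw [hzero.liminf_eq] at hle
  exact le_antisymm hle zero_le

/-- On measures carried by a finite set, evaluation at any measurable set is integration of a
fixed bounded continuous function. -/
theorem exists_boundedContinuous_integral_eq [NormalSpace X] [T1Space X] [OpensMeasurableSpace X]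
    {T V : Set X} (hT : T.Finite) (hV : MeasurableSet V) :
    ∃ f : X →ᵇ ℝ, ∀ ν : ProbabilityMeasure X, ν.toMeasure Tᶜ = 0 →
      ∫ y, f y ∂ν.toMeasure = (ν V : ℝ) := by
  obtain ⟨f, hf0, hf1, -⟩ := exists_bounded_zero_one_of_closed
    (hT.subset sdiff_subset : (T \ V).Finite).isClosed
    (hT.subset inter_subset_left : (T ∩ V).Finite).isClosed
    (disjoint_sdiff_inter)
  refine ⟨f, fun ν hν => ?_⟩
  have hae : (f : X → ℝ) =ᵐ[ν.toMeasure] V.indicator 1 := by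
    filter_upwards [compl_mem_ae_iff.2 hν] with y hy
    rw [compl_compl] at hy
    by_cases hyV : y ∈ V
    · simpa [hyV] using hf1 ⟨hy, hyV⟩
    · simpa [hyV] using hf0 ⟨hy, hyV⟩
  rw [integral_congr_ae hae, integral_indicator_one hV, ProbabilityMeasure.measureReal_eq_coe_coeFn]

end Support

/-- Membership in `Fmap` in terms of null sets: the measure is carried by the finite set
`msupp ζ ∩ ⋃ i, U i`. -/
theorem mem_Fmap_iff {X : Type*} [TopologicalSpace X] [T1Space X] [SecondCountableTopology X]
    [MeasurableSpace X] {𝒲 : Set (Set X)} {μ ζ ν : ProbabilityMeasure X} {n : ℕ}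
    {U : Fin n → Set X} {ε : ℝ} (hUW : ∃ W ∈ 𝒲, (⋃ i, U i) ⊆ W) (hζ : (msupp ζ).Finite) :
    ν ∈ Fmap 𝒲 μ U ε ζ ↔ ν.toMeasure (msupp ζ ∩ ⋃ i, U i)ᶜ = 0 ∧
      ∀ i, |(ν (U i) : ℝ) - (μ (U i) : ℝ)| ≤ ε := by
  rw [← msupp_subset_iff_measure_compl_eq_zero (hζ.subset inter_subset_left).isClosed,
    subset_inter_iff]
  obtain ⟨W, hW, hUW⟩ := hUW
  exact ⟨fun ⟨⟨_, h2, h3⟩, h4⟩ => ⟨⟨h4, h2⟩, h3⟩,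
    fun ⟨⟨h4, h2⟩, h3⟩ => ⟨⟨⟨hζ.subset h4, W, hW, h2.trans hUW⟩, h2, h3⟩, h4⟩⟩

/-- A measure carried by a finite disjoint family of sets can be replaced by one with the same
masses on the sets and carried by prescribed points in them. -/
theorem exists_probabilityMeasure_carried_by_points {X ι : Type*} [MeasurableSpace X]
    [MeasurableSingletonClass X] [Fintype ι]
    (μ : ProbabilityMeasure X) {U : ι → Set X} (hU : ∀ i, MeasurableSet (U i))
    (hdisj : Pairwise (Function.onFun Disjoint U)) (hμ : μ.toMeasure (⋃ i, U i)ᶜ = 0)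
    {z : ι → X} (hz : ∀ i, z i ∈ U i) :
    ∃ ν : ProbabilityMeasure X, ν.toMeasure (range z)ᶜ = 0 ∧ ∀ i, ν (U i) = μ (U i) := by
  classical
  have hsum : ∑ i, μ.toMeasure (U i) = 1 := by
    have h := measure_iUnion (μ := μ.toMeasure) hdisj hU
    rw [tsum_fintype] at h
    rw [← h]
    exact (prob_compl_eq_zero_iff (MeasurableSet.iUnion hU)).1 hμ
  let m : Measure X := ∑ i, μ.toMeasure (U i) • Measure.dirac (z i)
  have hm : ∀ s : Set X, m s = ∑ i, μ.toMeasure (U i) * Measure.dirac (z i) s := fun s => by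
    simp [m, Measure.finsetSum_apply]
  refine ⟨⟨m, ⟨by simp [hm, hsum]⟩⟩, ?_, fun j => ?_⟩
  · have : MeasurableSet (range z)ᶜ := (finite_range z).measurableSet.compl
    simp [hm, Measure.dirac_apply' _ this]
  · rw [ProbabilityMeasure.mk_apply, hm, Finset.sum_eq_single j]
    · simp [Measure.dirac_apply' _ (hU j), hz j, ProbabilityMeasure.coeFn_def]
    · intro i _ hij
      have : z i ∉ U j := (hdisj hij).notMem_of_mem_left (hz i)
      simp [Measure.dirac_apply' _ (hU j), this]
    · simp

theorem stmt_8 {X : Type*} [MetricSpace X] [CompactSpace X] [MeasurableSpace X] [BorelSpace X]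
    (𝒲 : Set (Set X)) (hWopen : ∀ W ∈ 𝒲, IsOpen W) (hWcover : ⋃₀ 𝒲 = Set.univ)
    (D : ℝ) (hD : 0 < D) (hWbdd : ∀ W ∈ 𝒲, Metric.diam W < D)
    (μ : ProbabilityMeasure X) (hμ : μ ∈ VietorisThickening 𝒲)
    (n : ℕ) (x : Fin n → X) (hxinj : Function.Injective x)
    (hsupp : msupp μ = Set.range x)
    (U : Fin n → Set X) (hUopen : ∀ i, IsOpen (U i))
    (hUdisj : Pairwise (Function.onFun Disjoint U))
    (hxU : ∀ i, x i ∈ U i)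
    (hUW : ∃ W ∈ 𝒲, (⋃ i, U i) ⊆ W)
    (ε : ℝ) (hε : 0 < ε)
    (ζ : ProbabilityMeasure X) (hζ : ζ ∈ PmeetsAll 𝒲 U) :
    (Fmap 𝒲 μ U ε ζ).Nonempty ∧
    (∀ ν₁ ∈ Fmap 𝒲 μ U ε ζ, ∀ ν₂ ∈ Fmap 𝒲 μ U ε ζ, ∀ t : ℝ≥0, t ≤ 1 →
      ∀ κ : ProbabilityMeasure X,
        κ.toMeasure = t • ν₁.toMeasure + (1 - t) • ν₂.toMeasure →
        κ ∈ Fmap 𝒲 μ U ε ζ) ∧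
    IsClosed (Fmap 𝒲 μ U ε ζ) := by
  have hfin : (msupp ζ).Finite := hζ.1.1
  have hTfin : (msupp ζ ∩ ⋃ i, U i).Finite := hfin.subset inter_subset_left
  refine ⟨?_, ?_, ?_⟩
  · choose z hzζ hzU using hζ.2
    have hμU : μ.toMeasure (⋃ i, U i)ᶜ = 0 := by
      refine measure_mono_null (compl_subset_compl.2 ?_)
        ((msupp_subset_iff_measure_compl_eq_zero (finite_range x).isClosed).1 hsupp.subset)
      rintro _ ⟨i, rfl⟩
      exact mem_iUnion_of_mem i (hxU i)
    obtain ⟨ν, hνz, hνU⟩ := exists_probabilityMeasure_carried_by_points μ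
      (fun i => (hUopen i).measurableSet) hUdisj hμU hzU
    refine ⟨ν, (mem_Fmap_iff hUW hfin).2 ⟨measure_mono_null (compl_subset_compl.2 ?_) hνz, ?_⟩⟩
    · rintro _ ⟨i, rfl⟩
      exact ⟨hzζ i, mem_iUnion_of_mem i (hzU i)⟩
    · intro i
      simpa [hνU i] using hε.le
  · intro ν₁ h₁ ν₂ h₂ t ht κ hκ
    rw [mem_Fmap_iff hUW hfin] at h₁ h₂ ⊢
    refine ⟨by simp [hκ, h₁.1, h₂.1], fun i => ?_⟩
    have hκU : (κ (U i) : ℝ) = t * ν₁ (U i) + (1 - t) * ν₂ (U i) := by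
      have : κ (U i) = t * ν₁ (U i) + (1 - t) * ν₂ (U i) := by
        rw [← ENNReal.coe_inj]
        push_cast [ProbabilityMeasure.ennreal_coeFn_eq_coeFn_toMeasure]
        rw [hκ, Measure.add_apply, Measure.smul_apply, Measure.smul_apply, ENNReal.smul_def,
          ENNReal.smul_def, smul_eq_mul, smul_eq_mul, ENNReal.coe_sub, ENNReal.coe_one]
      rw [this]
      push_cast [NNReal.coe_sub ht]
      rfl
    have hconv := convex_closedBall (μ (U i) : ℝ) ε (h₁.2 i) (h₂.2 i) t.coe_nonneg
      (sub_nonneg.2 (NNReal.coe_le_one.2 ht)) (add_sub_cancel _ _)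
    rw [hκU]
    exact hconv
  · choose f hf using fun i => exists_boundedContinuous_integral_eq hTfin (hUopen i).measurableSet
    have hF : Fmap 𝒲 μ U ε ζ = {ν | ν.toMeasure (msupp ζ ∩ ⋃ i, U i)ᶜ = 0} ∩
        ⋂ i, {ν | |∫ y, f i y ∂ν.toMeasure - (μ (U i) : ℝ)| ≤ ε} := by
      ext ν
      rw [mem_Fmap_iff hUW hfin, mem_inter_iff, mem_iInter]
      exact and_congr_right fun hν => forall_congr' fun i => by
        rw [mem_ofPred_eq, hf i ν hν]
    rw [hF]
    refine (isClosed_setOf_measure_eq_zero hTfin.isClosed.isOpen_compl).inter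
      (isClosed_iInter fun i => isClosed_le (Continuous.abs (Continuous.sub ?_ continuous_const))
        continuous_const)
    exact ProbabilityMeasure.continuous_integral_boundedContinuousFunction (f i)
end

section
/- Let μ ∈ V^m(𝒲) have support {x_1,…,x_n}, let 𝒰 = {U_1,…,U_n} be pairwise disjoint open subsets of X with x_i ∈ U_i for all i and with U_1 ∪ ⋯ ∪ U_n contained in some member of 𝒲, and let ε > 0. Then the set-valued map F is lower semicontinuous on P_𝒰: for every subset S of P(X) that is open in the weak topology, the set {ζ ∈ P_𝒰 : F(ζ) ∩ S ≠ ∅} is open in P_𝒰 (equivalently, open in V^m(𝒲), since P_𝒰 is open in V^m(𝒲)). -/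
open MeasureTheory Set

open Filter Topology

theorem msupp_eq_support {X : Type*} [TopologicalSpace X] [MeasurableSpace X]
    (μ : ProbabilityMeasure X) : msupp μ = μ.toMeasure.support := by
  ext x
  simp only [msupp, Measure.support_eq_forall_isOpen, Set.mem_ofPred_eq, pos_iff_ne_zero]
  exact forall_congr' fun _ => forall_comm

/-- A set of positive measure meets the support. -/
theorem msupp_inter_nonempty {X : Type*} [TopologicalSpace X] [SecondCountableTopology X]
    [MeasurableSpace X] (μ : ProbabilityMeasure X) {s : Set X} (hs : 0 < μ.toMeasure s) :
    (s ∩ msupp μ).Nonempty := by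
  rw [msupp_eq_support]
  exact Measure.nonempty_inter_support_of_pos hs

/-- Positivity on a fixed open set is an open condition for the weak topology. -/
theorem isOpen_setOf_measure_pos {X : Type*} [TopologicalSpace X] [MeasurableSpace X]
    [OpensMeasurableSpace X] [HasOuterApproxClosed X] {G : Set X} (hG : IsOpen G) :
    IsOpen {ζ : ProbabilityMeasure X | 0 < ζ.toMeasure G} := by
  rw [isOpen_iff_eventually]
  intro ζ hζ
  exact eventually_lt_of_lt_liminf (hζ.trans_le
    (ProbabilityMeasure.le_liminf_measure_open_of_tendsto (tendsto_id (x := 𝓝 ζ)) hG))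

section FiniteIndex

variable {X J : Type*} [TopologicalSpace X] [MeasurableSpace X] [Finite J] [MeasurableSpace J]
  [DiscreteMeasurableSpace J]

/-- The push-forward of a measure on a finite type depends continuously on the map. -/
theorem continuous_map_of_finite [OpensMeasurableSpace X] (m : ProbabilityMeasure J) :
    Continuous fun z : J → X => m.map (f := z) Measurable.of_discrete.aemeasurable := by
  have := Fintype.ofFinite J
  refine continuous_iff_continuousAt.2 fun z₀ => ?_
  refine ProbabilityMeasure.tendsto_iff_forall_lintegral_tendsto.2 fun f => ?_
  have key (z : J → X) :
      ∫⁻ ω, f ω ∂(m.map (f := z) Measurable.of_discrete.aemeasurable).toMeasure =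
        ∑ j, (f (z j) : ENNReal) * m.toMeasure {j} := by
    rw [ProbabilityMeasure.toMeasure_map, lintegral_map (by fun_prop) Measurable.of_discrete,
      lintegral_fintype]
  simp only [key]
  refine tendsto_finsetSum _ fun j _ => ?_
  refine ENNReal.Tendsto.mul_const ?_ (Or.inr (measure_ne_top _ _))
  exact Continuous.tendsto (f := fun z : J → X => (f (z j) : ENNReal)) (by fun_prop) z₀

theorem msupp_map_subset_range [T1Space X] [OpensMeasurableSpace X] (m : ProbabilityMeasure J)
    (z : J → X) :
    msupp (m.map (f := z) Measurable.of_discrete.aemeasurable) ⊆ Set.range z := by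
  intro p hp
  by_contra hpz
  have hop : IsOpen (Set.range z)ᶜ := (Set.finite_range z).isClosed.isOpen_compl
  refine hp _ hop hpz ?_
  rw [ProbabilityMeasure.toMeasure_map,
    Measure.map_apply Measurable.of_discrete hop.measurableSet]
  simp

end FiniteIndex

/-- A finitely supported probability measure is the push-forward of a probability measure on its
support along the inclusion. -/
theorem exists_map_val_eq {X : Type*} [TopologicalSpace X] [T1Space X]
    [SecondCountableTopology X] [MeasurableSpace X] [OpensMeasurableSpace X]
    (ν : ProbabilityMeasure X) (hν : (msupp ν).Finite) :
    ∃ m : ProbabilityMeasure (msupp ν),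
      m.map (f := Subtype.val) measurable_subtype_coe.aemeasurable = ν := by
  have hmeas : MeasurableSet (msupp ν) := hν.isClosed.measurableSet
  have hmap : (ν.toMeasure.comap (Subtype.val : msupp ν → X)).map Subtype.val = ν.toMeasure := by
    rw [(MeasurableEmbedding.subtype_coe hmeas).map_comap, Subtype.range_coe]
    refine Measure.restrict_eq_self_of_ae_mem ?_
    have := Measure.support_mem_ae (μ := ν.toMeasure)
    rwa [← msupp_eq_support] at this
  have hprob : IsProbabilityMeasure (ν.toMeasure.comap (Subtype.val : msupp ν → X)) := by
    constructor
    have := congrArg (fun ρ : Measure X => ρ Set.univ) hmap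
    simpa [Measure.map_apply measurable_subtype_coe MeasurableSet.univ] using this
  exact ⟨⟨_, hprob⟩, Subtype.ext hmap⟩

theorem stmt_9 {X : Type*} [MetricSpace X] [CompactSpace X] [MeasurableSpace X] [BorelSpace X]
    (𝒲 : Set (Set X)) (hWopen : ∀ W ∈ 𝒲, IsOpen W) (hWcover : ⋃₀ 𝒲 = Set.univ)
    (D : ℝ) (hD : 0 < D) (hWbdd : ∀ W ∈ 𝒲, Metric.diam W < D)
    (μ : ProbabilityMeasure X) (hμ : μ ∈ VietorisThickening 𝒲)
    (n : ℕ) (x : Fin n → X) (hxinj : Function.Injective x)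
    (hsupp : msupp μ = Set.range x)
    (U : Fin n → Set X) (hUopen : ∀ i, IsOpen (U i))
    (hUdisj : Pairwise (Function.onFun Disjoint U))
    (hxU : ∀ i, x i ∈ U i)
    (hUW : ∃ W ∈ 𝒲, (⋃ i, U i) ⊆ W)
    (ε : ℝ) (hε : 0 < ε) :
    ∀ S : Set (ProbabilityMeasure X), IsOpen S →
      IsOpen {ζ : PmeetsAll 𝒲 U |
        (Fmap 𝒲 μ U ε (ζ : ProbabilityMeasure X) ∩ S).Nonempty} := by
  intro S hS
  rw [isOpen_iff_mem_nhds]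
  rintro ⟨ζ₀, hζ₀⟩ ⟨ν₀, ⟨⟨⟨hfin, -⟩, hsub, hdist⟩, hle⟩, hνS⟩
  obtain ⟨m, hm⟩ := exists_map_val_eq ν₀ hfin
  have : Finite (msupp ν₀) := hfin
  let Φ : (msupp ν₀ → X) → ProbabilityMeasure X :=
    fun z => m.map (f := z) Measurable.of_discrete.aemeasurable
  have hΦ : Continuous Φ := continuous_map_of_finite m
  have hval : Φ Subtype.val = ν₀ := hm
  obtain ⟨V, hV, hVS⟩ := isOpen_pi_iff'.1 (hS.preimage hΦ) Subtype.val
    (by simpa [hval] using hνS)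
  choose i hi using fun j : msupp ν₀ => Set.mem_iUnion.1 (hsub j.2)
  have hGopen (j : msupp ν₀) : IsOpen (V j ∩ U (i j)) := (hV j).1.inter (hUopen _)
  have hev : ∀ᶠ ζ in 𝓝 ζ₀, ∀ j, 0 < ζ.toMeasure (V j ∩ U (i j)) :=
    eventually_all.2 fun j => (isOpen_setOf_measure_pos (hGopen j)).mem_nhds
      (pos_iff_ne_zero.2 (hle j.2 _ (hGopen j) ⟨(hV j).2, hi j⟩))
  filter_upwards [continuous_subtype_val.continuousAt.eventually hev] with ζ hζ
  choose z hz using fun j => msupp_inter_nonempty _ (hζ j)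
  have hrange : msupp (Φ z) ⊆ Set.range z := msupp_map_subset_range m z
  have hU : msupp (Φ z) ⊆ ⋃ k, U k := by
    refine hrange.trans ?_
    rintro _ ⟨j, rfl⟩
    exact Set.mem_iUnion.2 ⟨i j, (hz j).1.2⟩
  have hmass (k : Fin n) : Φ z (U k) = ν₀ (U k) := by
    have hmem {p : X} {l : Fin n} (hp : p ∈ U l) : p ∈ U k ↔ l = k := by
      refine ⟨fun hpk => ?_, fun h => h ▸ hp⟩
      by_contra hne
      exact Set.disjoint_left.1 (hUdisj hne) hp hpk
    have hpre : z ⁻¹' U k = Subtype.val ⁻¹' U k := by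
      ext j
      exact (hmem (hz j).1.2).trans (hmem (hi j)).symm
    rw [← hval, ProbabilityMeasure.map_apply _ _ (hUopen k).measurableSet,
      ProbabilityMeasure.map_apply _ _ (hUopen k).measurableSet, hpre]
  obtain ⟨W, hW, hUW⟩ := hUW
  refine ⟨Φ z, ⟨⟨⟨(Set.finite_range z).subset hrange, W, hW, hU.trans hUW⟩, hU, fun k => ?_⟩, ?_⟩,
    hVS fun j _ => (hz j).1.1⟩
  · rw [hmass]
    exact hdist k
  · refine hrange.trans ?_
    rintro _ ⟨j, rfl⟩
    exact (hz j).2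
end

section
/- Let Z be a metric space, let X ⊆ Z be a nonempty compact subset (with the induced metric), and let r > 0. Then the ambient Čech metric thickening Č^m(X,Z;r) is strictly strongly locally contractible: for every μ ∈ Č^m(X,Z;r) and every neighborhood U of μ in Č^m(X,Z;r), there exist a neighborhood V of μ with V ⊆ U and a continuous map H : [0,1] × V → V such that H(0,ν) = ν for all ν ∈ V, H(1,ν) = μ for all ν ∈ V, and H(t,μ) = μ for all t ∈ [0,1]. -/
open MeasureTheory Set

/-- The ambient Čech metric thickening `Čᵐ(X, Z; r)` of a subset `X ⊆ Z`: all finitely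
supported Borel probability measures on `X` whose support is contained in `X ∩ B_Z(z; r)`
for some `z ∈ Z`. -/
def CechThickening {Z : Type*} [MetricSpace Z] (X : Set Z) [MeasurableSpace X] (r : ℝ) :
    Set (ProbabilityMeasure X) :=
  {μ | (msupp μ).Finite ∧ ∃ z : Z, ∀ x ∈ msupp μ, dist (x : Z) z < r}

open Filter Topology Metric
open scoped NNReal ENNReal BoundedContinuousFunction

namespace CechContraction

section Support

variable {Y : Type*} [TopologicalSpace Y] [MeasurableSpace Y]

lemma msupp_eq_support (μ : ProbabilityMeasure Y) : msupp μ = (μ : Measure Y).support := by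
  ext x
  rw [(nhds_basis_opens x).mem_measureSupport]
  exact ⟨fun h U hU => pos_iff_ne_zero.2 (h U hU.2 hU.1), fun h U hU hx => (h U ⟨hx, hU⟩).ne'⟩

lemma measure_compl_msupp [HereditarilyLindelofSpace Y] (μ : ProbabilityMeasure Y) :
    (μ : Measure Y) (msupp μ)ᶜ = 0 := by
  rw [msupp_eq_support]
  exact Measure.measure_compl_support

lemma apply_inter_msupp [HereditarilyLindelofSpace Y] (μ : ProbabilityMeasure Y) (G : Set Y) :
    μ (G ∩ msupp μ) = μ G := by
  rw [← ENNReal.coe_inj]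
  simp only [ProbabilityMeasure.ennreal_coeFn_eq_coeFn_toMeasure]
  exact measure_inter_conull (measure_compl_msupp μ)

lemma apply_msupp [HereditarilyLindelofSpace Y] (μ : ProbabilityMeasure Y) : μ (msupp μ) = 1 := by
  simpa using apply_inter_msupp μ univ

lemma msupp_subset_of_absolutelyContinuous {μ ν : ProbabilityMeasure Y}
    (h : (μ : Measure Y) ≪ ν) : msupp μ ⊆ msupp ν := by
  rw [msupp_eq_support, msupp_eq_support]
  exact h.support_mono

lemma msupp_subset_union_of_absolutelyContinuous {ρ μ ν : ProbabilityMeasure Y}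
    (h : (ρ : Measure Y) ≪ (μ : Measure Y) + ν) : msupp ρ ⊆ msupp μ ∪ msupp ν := by
  simp only [msupp_eq_support, ← Measure.support_add]
  exact h.support_mono

lemma msupp_subset_of_isClosed {μ : ProbabilityMeasure Y} {F : Set Y} (hF : IsClosed F)
    (h : (μ : Measure Y) Fᶜ = 0) : msupp μ ⊆ F := by
  rw [msupp_eq_support]
  exact Measure.support_subset_of_isClosed hF h

end Support

section Blend

variable {Y : Type*} [TopologicalSpace Y] [MeasurableSpace Y]

/-- The integral of a nonnegative bounded continuous function against a probability measure. -/
noncomputable def pairing (ν : ProbabilityMeasure Y) (f : Y →ᵇ ℝ≥0) : ℝ≥0 :=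
  ν.toFiniteMeasure.testAgainstNN f

lemma coe_pairing (ν : ProbabilityMeasure Y) (f : Y →ᵇ ℝ≥0) :
    (pairing ν f : ℝ≥0∞) = ∫⁻ y, f y ∂(ν : Measure Y) := by
  simp only [pairing, FiniteMeasure.testAgainstNN_coe_eq]
  rfl

lemma pairing_mono (ν : ProbabilityMeasure Y) {f g : Y →ᵇ ℝ≥0} (h : ∀ y, f y ≤ g y) :
    pairing ν f ≤ pairing ν g :=
  FiniteMeasure.testAgainstNN_mono _ h

lemma pairing_one (ν : ProbabilityMeasure Y) : pairing ν 1 = 1 := by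
  simp [pairing]

lemma pairing_congr_ae (ν : ProbabilityMeasure Y) {f g : Y →ᵇ ℝ≥0}
    (h : ∀ᵐ y ∂(ν : Measure Y), f y = g y) : pairing ν f = pairing ν g := by
  rw [← ENNReal.coe_inj, coe_pairing, coe_pairing]
  exact lintegral_congr_ae (h.mono fun y hy => by simp [hy])

/-- The combination, with weights `a`, `b`, `c`, of `ν`, of `ν` reweighted by the
density `φ` and normalized, and of `μ`. -/
noncomputable def blendMeasure (φ : Y →ᵇ ℝ≥0) (μ ν : ProbabilityMeasure Y) (a b c : ℝ≥0) :
    Measure Y :=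
  a • (ν : Measure Y) + (b * (pairing ν φ)⁻¹) • (ν : Measure Y).withDensity (fun y => φ y) +
    c • (μ : Measure Y)

lemma blendMeasure_absolutelyContinuous (φ : Y →ᵇ ℝ≥0) (μ ν : ProbabilityMeasure Y)
    (a b c : ℝ≥0) : blendMeasure φ μ ν a b c ≪ (ν : Measure Y) + μ := by
  intro s hs
  obtain ⟨h₁, h₂⟩ : (ν : Measure Y) s = 0 ∧ (μ : Measure Y) s = 0 := by simpa using hs
  simp [blendMeasure, h₁, h₂, withDensity_absolutelyContinuous _ _ h₁]

lemma blendMeasure_zero_right_absolutelyContinuous (φ : Y →ᵇ ℝ≥0) (μ ν : ProbabilityMeasure Y)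
    (a b : ℝ≥0) : blendMeasure φ μ ν a b 0 ≪ (ν : Measure Y) := by
  intro s hs
  simp [blendMeasure, hs, withDensity_absolutelyContinuous _ _ hs]

lemma blendMeasure_zero_left_apply {φ : Y →ᵇ ℝ≥0} {μ : ProbabilityMeasure Y}
    (ν : ProbabilityMeasure Y) (b c : ℝ≥0) {s : Set Y} (hs : MeasurableSet s)
    (hφ : ∀ y ∈ s, φ y = 0) (hμ : (μ : Measure Y) s = 0) :
    blendMeasure φ μ ν 0 b c s = 0 := by
  have h : (ν : Measure Y).withDensity (fun y => φ y) s = 0 := by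
    rw [withDensity_apply _ hs, setLIntegral_congr_fun hs (g := fun _ => 0)]
    · simp
    · exact fun y hy => by simp [hφ y hy]
  simp [blendMeasure, h, hμ]

variable [OpensMeasurableSpace Y]

lemma continuous_pairing (f : Y →ᵇ ℝ≥0) :
    Continuous fun ν : ProbabilityMeasure Y => pairing ν f :=
  ProbabilityMeasure.continuous_testAgainstNN_eval f

lemma tendsto_iff_pairing {γ : Type*} {F : Filter γ} {ρ : γ → ProbabilityMeasure Y}
    {μ : ProbabilityMeasure Y} :
    Tendsto ρ F (𝓝 μ) ↔
      ∀ f : Y →ᵇ ℝ≥0, Tendsto (fun i => pairing (ρ i) f) F (𝓝 (pairing μ f)) := by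
  rw [ProbabilityMeasure.tendsto_nhds_iff_toFiniteMeasure_tendsto_nhds]
  exact FiniteMeasure.tendsto_iff_forall_testAgainstNN_tendsto

lemma lintegral_blendMeasure (φ : Y →ᵇ ℝ≥0) (μ ν : ProbabilityMeasure Y) (a b c : ℝ≥0)
    (f : Y →ᵇ ℝ≥0) :
    ∫⁻ y, f y ∂(blendMeasure φ μ ν a b c) =
      ((a * pairing ν f + b * (pairing ν φ)⁻¹ * pairing ν (φ * f) + c * pairing μ f : ℝ≥0) :
        ℝ≥0∞) := by
  have h : ∫⁻ y, f y ∂(ν : Measure Y).withDensity (fun y => φ y) = pairing ν (φ * f) := by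
    rw [lintegral_withDensity_eq_lintegral_mul _ φ.measurable_coe_ennreal_comp
      f.measurable_coe_ennreal_comp, coe_pairing]
    simp
  simp only [blendMeasure, lintegral_add_measure, lintegral_smul_measure, h, ← coe_pairing,
    ENNReal.smul_def, smul_eq_mul, ← ENNReal.coe_mul, ← ENNReal.coe_add]

lemma isProbabilityMeasure_blendMeasure {φ : Y →ᵇ ℝ≥0} (μ : ProbabilityMeasure Y)
    {ν : ProbabilityMeasure Y} {a b c : ℝ≥0} (habc : a + b + c = 1) (hφ : pairing ν φ ≠ 0) :
    IsProbabilityMeasure (blendMeasure φ μ ν a b c) := by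
  constructor
  have h := lintegral_blendMeasure φ μ ν a b c 1
  rw [mul_one, pairing_one, pairing_one, mul_assoc, inv_mul_cancel₀ hφ, mul_one, mul_one, mul_one,
    habc] at h
  simpa using h

/-- `blendMeasure` as a probability measure. -/
noncomputable def blend {φ : Y →ᵇ ℝ≥0} (μ : ProbabilityMeasure Y) {ν : ProbabilityMeasure Y}
    {a b c : ℝ≥0} (habc : a + b + c = 1) (hφ : pairing ν φ ≠ 0) : ProbabilityMeasure Y :=
  ⟨blendMeasure φ μ ν a b c, isProbabilityMeasure_blendMeasure μ habc hφ⟩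

lemma pairing_blend {φ : Y →ᵇ ℝ≥0} (μ : ProbabilityMeasure Y) {ν : ProbabilityMeasure Y}
    {a b c : ℝ≥0} (habc : a + b + c = 1) (hφ : pairing ν φ ≠ 0) (f : Y →ᵇ ℝ≥0) :
    pairing (blend μ habc hφ) f =
      a * pairing ν f + b * (pairing ν φ)⁻¹ * pairing ν (φ * f) + c * pairing μ f := by
  rw [← ENNReal.coe_inj, coe_pairing]
  exact lintegral_blendMeasure φ μ ν a b c f

end Blend

section Weights

/-- The weight of the initial measure at time `t`. -/
noncomputable def startWeight (t : unitInterval) : ℝ≥0 := Real.toNNReal (1 - 2 * (t : ℝ))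

/-- The weight of the reweighted measure at time `t`. -/
noncomputable def middleWeight (t : unitInterval) : ℝ≥0 := Real.toNNReal (1 - |2 * (t : ℝ) - 1|)

/-- The weight of the target measure at time `t`. -/
noncomputable def endWeight (t : unitInterval) : ℝ≥0 := Real.toNNReal (2 * (t : ℝ) - 1)

lemma weights_sum (t : unitInterval) : startWeight t + middleWeight t + endWeight t = 1 := by
  have h₀ := t.2.1
  have h₁ := t.2.2
  apply NNReal.coe_injective
  rcases le_total (2 * (t : ℝ) - 1) 0 with h | h
  · simp only [startWeight, middleWeight, endWeight, NNReal.coe_add, Real.coe_toNNReal',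
      abs_of_nonpos h, max_eq_right h]
    rw [max_eq_left (by linarith), max_eq_left (by linarith)]
    push_cast
    ring
  · simp only [startWeight, middleWeight, endWeight, NNReal.coe_add, Real.coe_toNNReal',
      abs_of_nonneg h, max_eq_left h]
    rw [max_eq_right (by linarith), max_eq_left (by linarith)]
    push_cast
    ring

lemma endWeight_eq_zero_or_startWeight_eq_zero (t : unitInterval) :
    endWeight t = 0 ∨ startWeight t = 0 := by
  rcases le_total (2 * (t : ℝ) - 1) 0 with h | h
  · exact Or.inl (Real.toNNReal_of_nonpos h)
  · exact Or.inr (Real.toNNReal_of_nonpos (by linarith))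

lemma continuous_startWeight : Continuous startWeight := by
  unfold startWeight; fun_prop

lemma continuous_middleWeight : Continuous middleWeight := by
  unfold middleWeight; fun_prop

lemma continuous_endWeight : Continuous endWeight := by
  unfold endWeight; fun_prop

end Weights

section Neighborhoods

variable {Y : Type*} [MetricSpace Y] [MeasurableSpace Y]

/-- The probability measures which charge the `δ`-thickening of each part of the support of `μ`
by more than `μ` does, up to an error `δ`. -/
def massNhd (μ : ProbabilityMeasure Y) {δ : ℝ≥0} (hδ : 0 < (δ : ℝ)) :
    Set (ProbabilityMeasure Y) :=
  {ν | ∀ S ⊆ msupp μ, μ S < pairing ν (thickenedIndicator hδ S) + δ}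

lemma le_pairing_thickenedIndicator (μ : ProbabilityMeasure Y) {δ : ℝ} (hδ : 0 < δ)
    {S : Set Y} (hS : MeasurableSet S) : μ S ≤ pairing μ (thickenedIndicator hδ S) := by
  rw [← ENNReal.coe_le_coe, coe_pairing, ProbabilityMeasure.ennreal_coeFn_eq_coeFn_toMeasure,
    ← lintegral_indicator_one hS]
  refine lintegral_mono fun y => ?_
  by_cases hy : y ∈ S <;> simp [hy, thickenedIndicator_one hδ S]

lemma pairing_ne_zero_of_mem_massNhd [HereditarilyLindelofSpace Y]
    {μ ν : ProbabilityMeasure Y} {δ : ℝ≥0} (hδ : 0 < (δ : ℝ))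
    (hδ₁ : δ ≤ 1) (hν : ν ∈ massNhd μ hδ) {φ : Y →ᵇ ℝ≥0}
    (hφ : ∀ y ∈ thickening δ (msupp μ), φ y = 1) : pairing ν φ ≠ 0 := by
  have h := hν _ Subset.rfl
  rw [apply_msupp] at h
  have h' : pairing ν (thickenedIndicator hδ (msupp μ)) ≤ pairing ν φ := by
    refine pairing_mono ν fun y => ?_
    by_cases hy : y ∈ thickening δ (msupp μ)
    · exact (thickenedIndicator_le_one hδ _ y).trans (hφ y hy).ge
    · simp [thickenedIndicator_zero hδ _ hy]
  intro h0
  rw [h0, nonpos_iff_eq_zero] at h'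
  rw [h', zero_add] at h
  exact absurd h hδ₁.not_gt

variable [OpensMeasurableSpace Y]

lemma pairing_thickenedIndicator_le (ν : ProbabilityMeasure Y) {δ : ℝ} (hδ : 0 < δ)
    (S : Set Y) : pairing ν (thickenedIndicator hδ S) ≤ ν (thickening δ S) := by
  rw [← ENNReal.coe_le_coe, coe_pairing, ProbabilityMeasure.ennreal_coeFn_eq_coeFn_toMeasure,
    ← lintegral_indicator_one isOpen_thickening.measurableSet]
  refine lintegral_mono fun y => ?_
  by_cases hy : y ∈ thickening δ S
  · simpa [hy] using thickenedIndicator_le_one hδ S y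
  · simp [hy, thickenedIndicator_zero hδ S hy]

lemma mem_massNhd_self {μ : ProbabilityMeasure Y} (hμ : (msupp μ).Finite) {δ : ℝ≥0}
    (hδ : 0 < (δ : ℝ)) : μ ∈ massNhd μ hδ := fun _ hS =>
  (le_pairing_thickenedIndicator μ hδ (hμ.subset hS).measurableSet).trans_lt
    (lt_add_of_pos_right _ hδ)

lemma isOpen_massNhd {μ : ProbabilityMeasure Y} (hμ : (msupp μ).Finite) {δ : ℝ≥0}
    (hδ : 0 < (δ : ℝ)) : IsOpen (massNhd μ hδ) := by
  have : massNhd μ hδ = ⋂ S ∈ {S | S ⊆ msupp μ},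
      {ν | μ S < pairing ν (thickenedIndicator hδ S) + δ} := by
    ext; simp [massNhd]
  rw [this]
  exact hμ.finite_subsets.isOpen_biInter fun S _ =>
    isOpen_lt continuous_const ((continuous_pairing _).add continuous_const)

lemma blend_mem_massNhd {μ ν : ProbabilityMeasure Y} (hμ : (msupp μ).Finite) {δ : ℝ≥0}
    (hδ : 0 < (δ : ℝ)) (hν : ν ∈ massNhd μ hδ) {φ : Y →ᵇ ℝ≥0}
    (hφ : ∀ y ∈ thickening δ (msupp μ), φ y = 1) (hφ₁ : ∀ y, φ y ≤ 1)
    {a b c : ℝ≥0} (habc : a + b + c = 1) (hne : pairing ν φ ≠ 0) :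
    blend μ habc hne ∈ massNhd μ hδ := by
  intro S hS
  set ψ := thickenedIndicator hδ S
  have hψ : φ * ψ = ψ := by
    ext y
    by_cases hy : y ∈ thickening δ S
    · simp [hφ y (thickening_subset_of_subset _ hS hy)]
    · simp [ψ, thickenedIndicator_zero hδ S hy]
  have h₁ : (1 : ℝ≥0) ≤ (pairing ν φ)⁻¹ :=
    (one_le_inv₀ (pos_iff_ne_zero.2 hne)).2 ((pairing_mono ν hφ₁).trans (pairing_one ν).le)
  have h₂ : μ S ≤ pairing μ ψ := le_pairing_thickenedIndicator μ hδ (hμ.subset hS).measurableSet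
  have h₃ : min (pairing ν ψ) (pairing μ ψ) ≤ pairing (blend μ habc hne) ψ := by
    rw [pairing_blend, hψ]
    calc min (pairing ν ψ) (pairing μ ψ)
        = a * min (pairing ν ψ) (pairing μ ψ) + b * 1 * min (pairing ν ψ) (pairing μ ψ)
          + c * min (pairing ν ψ) (pairing μ ψ) := by
          rw [mul_one, ← add_mul, ← add_mul, habc, one_mul]
      _ ≤ _ := by
          gcongr
          · exact min_le_left _ _
          · exact min_le_left _ _
          · exact min_le_right _ _
  refine lt_of_lt_of_le ?_ (add_le_add_left h₃ _)
  rcases min_choice (pairing ν ψ) (pairing μ ψ) with h | h <;> rw [h]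
  · exact hν S hS
  · exact h₂.trans_lt (lt_add_of_pos_right _ hδ)

lemma exists_massNhd_subset [HereditarilyLindelofSpace Y] [BorelSpace Y]
    {μ : ProbabilityMeasure Y} (hμ : (msupp μ).Finite)
    {U : Set (ProbabilityMeasure Y)} (hU : U ∈ 𝓝 μ) :
    ∃ δ₀ : ℝ, 0 < δ₀ ∧ ∀ (δ : ℝ≥0) (hδ : 0 < (δ : ℝ)), (δ : ℝ) < δ₀ → massNhd μ hδ ⊆ U := by
  by_contra! hcon
  have hpos (n : ℕ) : (0 : ℝ) < 1 / ((n : ℝ) + 1) := by positivity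
  choose δ hδ hδn hsub using fun n => hcon _ (hpos n)
  simp only [not_subset] at hsub
  choose ν hν hνU using hsub
  have hlim : Tendsto (fun n => (δ n : ℝ)) atTop (𝓝 0) :=
    squeeze_zero (fun n => (hδ n).le) (fun n => (hδn n).le) tendsto_one_div_add_atTop_nhds_zero_nat
  have hlim' : Tendsto (fun n => (δ n : ℝ≥0∞)) atTop (𝓝 0) := by
    have : Tendsto δ atTop (𝓝 0) := NNReal.tendsto_coe.1 (by simpa using hlim)
    simpa using ENNReal.tendsto_coe.2 this
  have key : Tendsto ν atTop (𝓝 μ) := by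
    refine tendsto_of_forall_isOpen_le_liminf' fun G hG => ?_
    obtain ⟨ε, hε, hεG⟩ := (hμ.subset (inter_subset_right (s := G))).isCompact
      |>.exists_thickening_subset_open hG inter_subset_left
    have hev : ∀ᶠ n in atTop,
        (μ : Measure Y) G - δ n ≤ (ν n : Measure Y) G := by
      filter_upwards [hlim.eventually (gt_mem_nhds hε)] with n hn
      rw [tsub_le_iff_right]
      have h₁ := (hν n (G ∩ msupp μ) inter_subset_right).le
      rw [apply_inter_msupp] at h₁
      have h₂ : pairing (ν n) (thickenedIndicator (hδ n) (G ∩ msupp μ)) ≤ ν n G :=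
        (pairing_thickenedIndicator_le _ _ _).trans
          (ProbabilityMeasure.apply_mono _ ((thickening_mono hn.le _).trans hεG))
      have h₃ := h₁.trans (add_le_add_left h₂ _)
      rw [← ENNReal.coe_le_coe] at h₃
      simpa [ProbabilityMeasure.ennreal_coeFn_eq_coeFn_toMeasure] using h₃
    have hl : Tendsto (fun n => (μ : Measure Y) G - δ n) atTop (𝓝 ((μ : Measure Y) G)) := by
      simpa using ENNReal.Tendsto.sub tendsto_const_nhds hlim' (Or.inl (measure_ne_top _ G))
    rw [← hl.liminf_eq]
    exact liminf_le_liminf hev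
  obtain ⟨n, hn⟩ := (key.eventually hU).exists
  exact hνU n hn

end Neighborhoods

/-- A Vietoris metric thickening of a family of open sets is strictly strongly locally
contractible. -/
theorem exists_contractible_nhd {Y : Type*} [MetricSpace Y] [MeasurableSpace Y] [BorelSpace Y]
    [HereditarilyLindelofSpace Y] (𝒲 : Set (Set Y)) (h𝒲 : ∀ W ∈ 𝒲, IsOpen W)
    (C : Set (ProbabilityMeasure Y))
    (hC : ∀ ν, ν ∈ C ↔ (msupp ν).Finite ∧ ∃ W ∈ 𝒲, msupp ν ⊆ W)
    (μ : C) (U : Set C) (hU : U ∈ 𝓝 μ) :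
    ∃ V : Set C, V ∈ 𝓝 μ ∧ V ⊆ U ∧
      ∃ (hμV : μ ∈ V) (H : unitInterval × V → V),
        Continuous H ∧
        (∀ ν : V, H (0, ν) = ν) ∧
        (∀ ν : V, H (1, ν) = ⟨μ, hμV⟩) ∧
        (∀ t : unitInterval, H (t, ⟨μ, hμV⟩) = ⟨μ, hμV⟩) := by
  obtain ⟨hμ, W, hW, hμW⟩ := (hC μ).1 μ.2
  obtain ⟨U', hU', hUU'⟩ := mem_nhds_induced _ _ _ |>.1 hU
  obtain ⟨δ₀, hδ₀, hsub⟩ := exists_massNhd_subset hμ hU'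
  obtain ⟨ε, hε, hεW⟩ := hμ.isCompact.exists_cthickening_subset_open (h𝒲 W hW) hμW
  obtain ⟨δ, hδ, hδmin⟩ := exists_between (show (0 : ℝ) < min δ₀ (min 1 (ε / 2)) by positivity)
  lift δ to ℝ≥0 using hδ.le
  simp only [lt_min_iff] at hδmin
  obtain ⟨hδδ₀, hδ₁, hδε⟩ := hδmin
  replace hδ₁ : δ ≤ 1 := by exact_mod_cast hδ₁.le
  set φ : Y →ᵇ ℝ≥0 := thickenedIndicator hδ (thickening δ (msupp (μ : ProbabilityMeasure Y)))
  have hφ : ∀ y ∈ thickening δ (msupp (μ : ProbabilityMeasure Y)), φ y = 1 :=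
    fun y hy => thickenedIndicator_one hδ _ hy
  have hφ₁ : ∀ y, φ y ≤ 1 := thickenedIndicator_le_one hδ _
  set K := cthickening ε (msupp (μ : ProbabilityMeasure Y))
  have hφK : ∀ y ∈ Kᶜ, φ y = 0 := fun y hy => thickenedIndicator_zero hδ _ fun hy' =>
    hy (cthickening_mono (by linarith) _
      (thickening_subset_cthickening _ _ (thickening_thickening_subset _ _ _ hy')))
  have hμK : ((μ : ProbabilityMeasure Y) : Measure Y) Kᶜ = 0 :=
    measure_mono_null (compl_subset_compl.2 (self_subset_cthickening _)) (measure_compl_msupp _)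
  set V : Set C := {ν | (ν : ProbabilityMeasure Y) ∈ massNhd (μ : ProbabilityMeasure Y) hδ}
  have hμV : μ ∈ V := mem_massNhd_self hμ hδ
  have hne (ν : V) : pairing (ν : ProbabilityMeasure Y) φ ≠ 0 :=
    pairing_ne_zero_of_mem_massNhd hδ hδ₁ ν.2 hφ
  have hmem (t : unitInterval) (ν : V) : blend (μ : ProbabilityMeasure Y) (weights_sum t) (hne ν)
      ∈ C := by
    obtain ⟨hν, W', hW', hνW'⟩ := (hC _).1 ν.1.2
    refine (hC _).2 ⟨(hν.union hμ).subset (msupp_subset_union_of_absolutelyContinuous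
      (blendMeasure_absolutelyContinuous φ _ _ _ _ _)), ?_⟩
    rcases endWeight_eq_zero_or_startWeight_eq_zero t with ht | ht
    · refine ⟨W', hW', (msupp_subset_of_absolutelyContinuous ?_).trans hνW'⟩
      change blendMeasure φ _ _ _ _ (endWeight t) ≪ _
      rw [ht]
      exact blendMeasure_zero_right_absolutelyContinuous φ _ _ _ _
    · refine ⟨W, hW, (msupp_subset_of_isClosed isClosed_cthickening ?_).trans hεW⟩
      change blendMeasure φ _ _ (startWeight t) _ _ _ = 0
      rw [ht]
      exact blendMeasure_zero_left_apply _ _ _ isClosed_cthickening.measurableSet.compl hφK hμK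
  refine ⟨V, ?_, fun ν hν => hUU' (hsub δ hδ hδδ₀ hν), hμV,
    fun p => ⟨⟨_, hmem p.1 p.2⟩,
      blend_mem_massNhd hμ hδ p.2.2 hφ hφ₁ (weights_sum p.1) (hne p.2)⟩, ?_, ?_, ?_, ?_⟩
  · exact ((isOpen_massNhd hμ hδ).preimage continuous_subtype_val).mem_nhds hμV
  · refine Continuous.subtype_mk (Continuous.subtype_mk ?_ _) _
    refine continuous_iff_continuousAt.2 fun p => tendsto_iff_pairing.2 fun f => ?_
    simp only [pairing_blend]
    refine Continuous.tendsto (f := fun p : unitInterval × V => _) ?_ p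
    have hc (g : Y →ᵇ ℝ≥0) :
        Continuous fun p : unitInterval × V => pairing (p.2 : ProbabilityMeasure Y) g :=
      (continuous_pairing g).comp
        (continuous_subtype_val.comp (continuous_subtype_val.comp continuous_snd))
    exact (((continuous_startWeight.comp continuous_fst).mul (hc f)).add
      (((continuous_middleWeight.comp continuous_fst).mul
        ((hc φ).inv₀ fun p => hne p.2)).mul (hc _))).add
      ((continuous_endWeight.comp continuous_fst).mul continuous_const)
  · refine fun ν => Subtype.ext (Subtype.ext (Subtype.ext ?_))
    change blendMeasure φ _ _ (startWeight 0) (middleWeight 0) (endWeight 0) = _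
    have h : endWeight 0 = 0 := Real.toNNReal_of_nonpos (by simp)
    simp [blendMeasure, startWeight, middleWeight, h]
  · refine fun ν => Subtype.ext (Subtype.ext (Subtype.ext ?_))
    change blendMeasure φ _ _ (startWeight 1) (middleWeight 1) (endWeight 1) = _
    have h : startWeight 1 = 0 := Real.toNNReal_of_nonpos (by norm_num)
    norm_num [blendMeasure, middleWeight, endWeight, h]
  · refine fun t => Subtype.ext (Subtype.ext (Subtype.ext ?_))
    have hae : ∀ᵐ y ∂((μ : ProbabilityMeasure Y) : Measure Y), φ y = 1 := by
      refine mem_of_superset (compl_mem_ae_iff.2 (measure_compl_msupp _)) fun y hy => ?_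
      exact hφ y (self_subset_thickening hδ _ (not_not.1 hy))
    have hp : pairing (μ : ProbabilityMeasure Y) φ = 1 :=
      (pairing_congr_ae _ hae).trans (pairing_one _)
    have hd : ((μ : ProbabilityMeasure Y) : Measure Y).withDensity (fun y => φ y)
        = ((μ : ProbabilityMeasure Y) : Measure Y) := by
      rw [withDensity_congr_ae (g := 1) (hae.mono fun y hy => by simp [hy]), withDensity_one]
    change blendMeasure φ _ _ (startWeight t) (middleWeight t) (endWeight t) = _
    rw [blendMeasure, hp, hd, inv_one, mul_one, ← add_smul, ← add_smul, weights_sum]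
    exact one_smul _ _

end CechContraction

theorem stmt_14 {Z : Type*} [MetricSpace Z] [MeasurableSpace Z] [BorelSpace Z]
    (X : Set Z) (hXcpt : IsCompact X) (hXne : X.Nonempty)
    (r : ℝ) (hr : 0 < r)
    (μ : CechThickening X r) (U : Set (CechThickening X r)) (hU : U ∈ nhds μ) :
    ∃ V : Set (CechThickening X r), V ∈ nhds μ ∧ V ⊆ U ∧
      ∃ (hμV : μ ∈ V) (H : unitInterval × V → V),
        Continuous H ∧
        (∀ ν : V, H (0, ν) = ν) ∧
        (∀ ν : V, H (1, ν) = ⟨μ, hμV⟩) ∧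
        (∀ t : unitInterval, H (t, ⟨μ, hμV⟩) = ⟨μ, hμV⟩) := by
  have : CompactSpace X := isCompact_iff_compactSpace.1 hXcpt
  refine CechContraction.exists_contractible_nhd
    (range fun z : Z => {x : X | dist (x : Z) z < r}) ?_ _ (fun ν => ?_) μ U hU
  · rintro _ ⟨z, rfl⟩
    exact isOpen_lt (by fun_prop) continuous_const
  · simp only [exists_range_iff]
    rfl
end
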